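/- arXiv:2404.05867 — 2 statements merged into one kernel-verified Lean document; each statement's English description precedes it below -/
import Mathlib

section
/- Let ρ_ABC be a density matrix on H_A ⊗ H_B ⊗ H_C satisfying I(A:C|B)_ρ = 0, and let P_AB, P_BC, P_ABC be the orthogonal projections onto the supports of ρ_AB, ρ_BC, ρ_ABC. Then the kernel of the positive semidefinite operator (1 − P_AB ⊗ 1_C) + (1 − 1_A ⊗ P_BC) equals the range of P_ABC; equivalently, a vector ψ ∈ H_A ⊗ H_B ⊗ H_C satisfies (P_AB ⊗ 1_C)ψ = ψ and (1_A ⊗ P_BC)ψ = ψ if and only if P_ABC ψ = ψ. -/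
open Matrix Kronecker BigOperators
open scoped ComplexOrder

/-- A density matrix: a positive semidefinite matrix of trace one. -/
def IsDensityMatrix {n : Type*} [Fintype n] (ρ : Matrix n n ℂ) : Prop :=
  ρ.PosSemidef ∧ ρ.trace = 1

/-- `P` is the orthogonal projection onto the support of `ρ`, i.e. `P` is a Hermitian
idempotent whose kernel is exactly the kernel of `ρ`. -/
def IsSupportProj {n : Type*} [Fintype n] (ρ P : Matrix n n ℂ) : Prop :=
  P.IsHermitian ∧ P * P = P ∧ ∀ v : n → ℂ, ρ.mulVec v = 0 ↔ P.mulVec v = 0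

/-- The von Neumann entropy `S(ρ) = -Tr(ρ log ρ)`, computed via the eigenvalues of a
Hermitian matrix (with the convention `0 log 0 = 0`). -/
noncomputable def vNEntropy {n : Type*} [Fintype n] [DecidableEq n]
    (ρ : Matrix n n ℂ) : ℝ :=
  if h : ρ.IsHermitian then -∑ i, h.eigenvalues i * Real.log (h.eigenvalues i) else 0

/-- Reduced density matrix on `A × B` (partial trace over `C`). -/
noncomputable def margAB {A B C : Type*} [Fintype C]
    (ρ : Matrix (A × B × C) (A × B × C) ℂ) : Matrix (A × B) (A × B) ℂ :=
  Matrix.of fun p q => ∑ c : C, ρ (p.1, p.2, c) (q.1, q.2, c)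

/-- Reduced density matrix on `B × C` (partial trace over `A`). -/
noncomputable def margBC {A B C : Type*} [Fintype A]
    (ρ : Matrix (A × B × C) (A × B × C) ℂ) : Matrix (B × C) (B × C) ℂ :=
  Matrix.of fun p q => ∑ a : A, ρ (a, p) (a, q)

/-- Reduced density matrix on `B` (partial trace over `A` and `C`). -/
noncomputable def margB {A B C : Type*} [Fintype A] [Fintype C]
    (ρ : Matrix (A × B × C) (A × B × C) ℂ) : Matrix B B ℂ :=
  Matrix.of fun b b' => ∑ a : A, ∑ c : C, ρ (a, b, c) (a, b', c)

/-- Conditional mutual information `I(A:C|B) = S(AB) + S(BC) - S(B) - S(ABC)`. -/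
noncomputable def CMI {A B C : Type*} [Fintype A] [DecidableEq A]
    [Fintype B] [DecidableEq B] [Fintype C] [DecidableEq C]
    (ρ : Matrix (A × B × C) (A × B × C) ℂ) : ℝ :=
  vNEntropy (margAB ρ) + vNEntropy (margBC ρ) - vNEntropy (margB ρ) - vNEntropy ρ


/-- `U` is a unitary matrix whose columns are eigenvectors of `ρ` with eigenvalues `r`. -/
structure IsDiagonalization {n : Type*} [Fintype n] [DecidableEq n]
    (ρ U : Matrix n n ℂ) (r : n → ℝ) : Prop where
  conjTranspose_mul_self : Uᴴ * U = 1
  mul_conjTranspose_self : U * Uᴴ = 1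
  eq : ρ = U * diagonal (fun i => (r i : ℂ)) * Uᴴ

theorem Matrix.IsHermitian.isDiagonalization {n : Type*} [Fintype n] [DecidableEq n]
    {ρ : Matrix n n ℂ} (h : ρ.IsHermitian) :
    IsDiagonalization ρ (h.eigenvectorUnitary : Matrix n n ℂ) h.eigenvalues where
  conjTranspose_mul_self := by
    simp [← star_eq_conjTranspose]
  mul_conjTranspose_self := by
    simp [← star_eq_conjTranspose]
  eq := by
    conv_lhs => rw [h.spectral_theorem, Unitary.conjStarAlgAut_apply]
    rfl

section Resolvent

variable {n : Type*} [Fintype n] [DecidableEq n]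

/-- The solution `X` of `σ X + t X ρ = ρ`, written in eigenbases of `σ` and `ρ`. -/
noncomputable def modularResolvent (V : Matrix n n ℂ) (s : n → ℝ) (U : Matrix n n ℂ) (r : n → ℝ)
    (t : ℝ) : Matrix n n ℂ :=
  V * Matrix.of (fun j k => (Vᴴ * U) j k * ((r k / (s j + t * r k) : ℝ) : ℂ)) * Uᴴ

/-- An antiderivative in `t` of `Tr (Xᴴ ρ)`, where `X` is the solution of `σ X + t X ρ = ρ`. -/
noncomputable def logOverlap (V : Matrix n n ℂ) (s : n → ℝ) (U : Matrix n n ℂ) (r : n → ℝ)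
    (t : ℝ) : ℝ :=
  ∑ j, ∑ k, Complex.normSq ((Vᴴ * U) j k) * (r k * Real.log (s j + t * r k))

variable {ρ σ U V : Matrix n n ℂ} {r s : n → ℝ}

theorem modularResolvent_spec (hρ : IsDiagonalization ρ U r) (hσ : IsDiagonalization σ V s)
    (hr : ∀ k, 0 ≤ r k) (hs : ∀ j, 0 ≤ s j) {t : ℝ} (ht : 0 < t) :
    σ * modularResolvent V s U r t + (t : ℂ) • (modularResolvent V s U r t * ρ) = ρ := by
  set N : Matrix n n ℂ :=
    Matrix.of (fun j k => (Vᴴ * U) j k * ((r k / (s j + t * r k) : ℝ) : ℂ)) with hN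
  have key : diagonal (fun i => (s i : ℂ)) * N + (t : ℂ) • (N * diagonal (fun i => (r i : ℂ)))
      = Vᴴ * U * diagonal (fun i => (r i : ℂ)) := by
    ext j k
    simp only [Matrix.add_apply, Matrix.smul_apply, diagonal_mul, mul_diagonal, hN, of_apply,
      smul_eq_mul]
    rcases (hr k).eq_or_lt with h | h
    · simp [← h]
    · have h1 : s j + t * r k ≠ 0 := by have := hs j; positivity
      have h2 : ((r k / (s j + t * r k) : ℝ) : ℂ) * (s j + t * r k) = r k := by
        rw [← Complex.ofReal_mul, ← Complex.ofReal_add, ← Complex.ofReal_mul,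
          div_mul_cancel₀ _ h1]
      linear_combination (Vᴴ * U) j k * h2
  have e1 : σ * modularResolvent V s U r t = V * (diagonal (fun i => (s i : ℂ)) * N) * Uᴴ := by
    simp only [modularResolvent, ← hN, hσ.eq, Matrix.mul_assoc]
    rw [← Matrix.mul_assoc Vᴴ V, hσ.conjTranspose_mul_self, Matrix.one_mul]
  have e2 : modularResolvent V s U r t * ρ = V * (N * diagonal (fun i => (r i : ℂ))) * Uᴴ := by
    simp only [modularResolvent, ← hN, hρ.eq, Matrix.mul_assoc]
    rw [← Matrix.mul_assoc Uᴴ U, hρ.conjTranspose_mul_self, Matrix.one_mul]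
  have e3 : ρ = V * (Vᴴ * U * diagonal (fun i => (r i : ℂ))) * Uᴴ := by
    rw [← Matrix.mul_assoc, ← Matrix.mul_assoc, hσ.mul_conjTranspose_self, Matrix.one_mul, hρ.eq]
  rw [e1, e2]
  conv_rhs => rw [e3, ← key]
  simp only [Matrix.mul_add, Matrix.add_mul, Matrix.mul_smul, Matrix.smul_mul]

theorem trace_modularResolvent (hρ : IsDiagonalization ρ U r) (t : ℝ) :
    ((modularResolvent V s U r t)ᴴ * ρ).trace =
      ((∑ j, ∑ k, Complex.normSq ((Vᴴ * U) j k) * (r k * (r k / (s j + t * r k))) : ℝ) : ℂ) := by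
  set N : Matrix n n ℂ :=
    Matrix.of (fun j k => (Vᴴ * U) j k * ((r k / (s j + t * r k) : ℝ) : ℂ)) with hN
  have e : (modularResolvent V s U r t)ᴴ * ρ
      = U * (Nᴴ * (Vᴴ * U * diagonal (fun i => (r i : ℂ)))) * Uᴴ := by
    simp only [modularResolvent, ← hN, hρ.eq, Matrix.mul_assoc, conjTranspose_mul,
      conjTranspose_conjTranspose]
  rw [e, trace_mul_comm, ← Matrix.mul_assoc, hρ.conjTranspose_mul_self, Matrix.one_mul]
  simp only [trace, diag_apply, mul_apply (M := Nᴴ), conjTranspose_apply]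
  rw [Finset.sum_comm]
  push_cast
  refine Finset.sum_congr rfl fun j _ => Finset.sum_congr rfl fun k _ => ?_
  simp only [hN, of_apply, mul_diagonal, Complex.normSq_eq_conj_mul_self, star_mul',
    Complex.star_def, Complex.conj_ofReal]
  push_cast
  ring

theorem hasDerivAt_logOverlap (hr : ∀ k, 0 ≤ r k) (hs : ∀ j, 0 ≤ s j) {t : ℝ} (ht : 0 < t) :
    HasDerivAt (logOverlap V s U r)
      (∑ j, ∑ k, Complex.normSq ((Vᴴ * U) j k) * (r k * (r k / (s j + t * r k)))) t := by
  unfold logOverlap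
  refine HasDerivAt.fun_sum fun j _ => HasDerivAt.fun_sum fun k _ => HasDerivAt.const_mul _ ?_
  rcases (hr k).eq_or_lt with h | h
  · simpa [← h] using hasDerivAt_const t (0 : ℝ)
  · have h1 : s j + t * r k ≠ 0 := by have := hs j; positivity
    have : HasDerivAt (fun x => s j + x * r k) (r k) t := by
      simpa using ((hasDerivAt_id t).mul_const (r k)).const_add (s j)
    exact (this.log h1).const_mul _

theorem IsDiagonalization.overlap_eq_zero (hρ : IsDiagonalization ρ U r)
    (hσ : IsDiagonalization σ V s) (hker : ∀ v, σ.mulVec v = 0 → ρ.mulVec v = 0)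
    {j k : n} (hj : s j = 0) (hk : r k ≠ 0) : (Vᴴ * U) j k = 0 := by
  have h1 : σ * V = V * diagonal (fun i => (s i : ℂ)) := by
    rw [hσ.eq, Matrix.mul_assoc, hσ.conjTranspose_mul_self, Matrix.mul_one]
  have h2 : σ.mulVec (V.col j) = 0 := by
    ext i
    have := congrFun (congrFun h1 i) j
    rw [mul_diagonal, hj, Complex.ofReal_zero, mul_zero] at this
    exact this
  have h3 := hker _ h2
  have h4 : diagonal (fun i => (r i : ℂ)) * (Uᴴ * V) = Uᴴ * (ρ * V) := by
    rw [hρ.eq]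
    simp only [Matrix.mul_assoc]
    rw [← Matrix.mul_assoc Uᴴ U, hρ.conjTranspose_mul_self, Matrix.one_mul]
  have h5 : (Uᴴ * (ρ * V)) k j = 0 := by
    have : ∀ i, (ρ * V) i j = 0 := fun i => congrFun h3 i
    simp [mul_apply (M := Uᴴ), this]
  rw [← h4, diagonal_mul] at h5
  have h6 : (Uᴴ * V) k j = 0 := by simpa [hk] using h5
  have h7 : (Vᴴ * U) = (Uᴴ * V)ᴴ := by simp
  rw [h7, conjTranspose_apply, h6, star_zero]

theorem continuousOn_logOverlap (hρ : IsDiagonalization ρ U r) (hσ : IsDiagonalization σ V s)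
    (hker : ∀ v, σ.mulVec v = 0 → ρ.mulVec v = 0) (hr : ∀ k, 0 ≤ r k) (hs : ∀ j, 0 ≤ s j) :
    ContinuousOn (logOverlap V s U r) (Set.Ici 0) := by
  unfold logOverlap
  refine continuousOn_finsetSum _ fun j _ => continuousOn_finsetSum _ fun k _ => ?_
  rcases (hs j).eq_or_lt with h | h
  · by_cases hk : r k = 0
    · simp [hk, continuousOn_const]
    · simp [hρ.overlap_eq_zero hσ hker h.symm hk, continuousOn_const]
  · refine continuousOn_const.mul (continuousOn_const.mul (ContinuousOn.log (by fun_prop) ?_))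
    intro t ht
    have := hr k
    have ht' : 0 ≤ t := ht
    positivity

theorem sum_normSq_col {W : Matrix n n ℂ} (hW : Wᴴ * W = 1) (k : n) :
    ∑ j, Complex.normSq (W j k) = 1 := by
  have := congrFun (congrFun hW k) k
  simp only [mul_apply, conjTranspose_apply, one_apply_eq, Complex.star_def,
    ← Complex.normSq_eq_conj_mul_self] at this
  exact_mod_cast this

theorem IsDiagonalization.overlap_isometry (hρ : IsDiagonalization ρ U r)
    (hσ : IsDiagonalization σ V s) : (Vᴴ * U)ᴴ * (Vᴴ * U) = 1 := by
  rw [conjTranspose_mul, conjTranspose_conjTranspose, Matrix.mul_assoc, ← Matrix.mul_assoc V,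
    hσ.mul_conjTranspose_self, Matrix.one_mul, hρ.conjTranspose_mul_self]

open Filter Topology in
theorem tendsto_logOverlap (hρ : IsDiagonalization ρ U r) (hσ : IsDiagonalization σ V s)
    (hr : ∀ k, 0 ≤ r k) :
    Tendsto (fun t => logOverlap V s U r t - (∑ k, r k) * Real.log t) atTop
      (𝓝 (∑ k, r k * Real.log (r k))) := by
  have hcol : ∀ f : n → ℝ, ∑ j, ∑ k, Complex.normSq ((Vᴴ * U) j k) * f k = ∑ k, f k := by
    intro f
    rw [Finset.sum_comm]
    refine Finset.sum_congr rfl fun k _ => ?_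
    rw [← Finset.sum_mul, sum_normSq_col (hρ.overlap_isometry hσ), one_mul]
  have : ∀ t, logOverlap V s U r t - (∑ k, r k) * Real.log t =
      ∑ j, ∑ k, Complex.normSq ((Vᴴ * U) j k) *
        (r k * Real.log (s j + t * r k) - r k * Real.log t) := by
    intro t
    rw [Finset.sum_mul, ← hcol, logOverlap, ← Finset.sum_sub_distrib]
    refine Finset.sum_congr rfl fun j _ => ?_
    rw [← Finset.sum_sub_distrib]
    exact Finset.sum_congr rfl fun k _ => by ring
  rw [tendsto_congr this, ← hcol fun k => r k * Real.log (r k)]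
  refine tendsto_finsetSum _ fun j _ => tendsto_finsetSum _ fun k _ => Tendsto.const_mul _ ?_
  rcases (hr k).eq_or_lt with h | h
  · simp [← h]
  · have h1 : Tendsto (fun t : ℝ => s j / t + r k) atTop (𝓝 (r k)) := by
      simpa using (tendsto_const_nhds.div_atTop tendsto_id).add_const (r k)
    refine ((h1.log h.ne').const_mul (r k)).congr' ?_
    filter_upwards [eventually_gt_atTop 0, (h1.eventually (lt_mem_nhds h))] with t ht ht2
    rw [← mul_sub]
    congr 1
    rw [eq_sub_iff_add_eq, ← Real.log_mul ht2.ne' ht.ne']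
    congr 1
    field_simp

open Filter Topology in
theorem tendsto_smul_modularResolvent (hσ : IsDiagonalization σ V s)
    (hr : ∀ k, 0 ≤ r k) :
    Tendsto (fun t : ℝ => (t : ℂ) • modularResolvent V s U r t) atTop
      (𝓝 (U * diagonal (fun k => if r k = 0 then (0 : ℂ) else 1) * Uᴴ)) := by
  have e : U * diagonal (fun k => if r k = 0 then (0 : ℂ) else 1) * Uᴴ
      = V * (Vᴴ * U * diagonal (fun k => if r k = 0 then (0 : ℂ) else 1)) * Uᴴ := by
    rw [← Matrix.mul_assoc V, ← Matrix.mul_assoc V, hσ.mul_conjTranspose_self, Matrix.one_mul]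
  rw [e]
  have e' : ∀ t : ℝ, (t : ℂ) • modularResolvent V s U r t = V * ((t : ℂ) •
      Matrix.of (fun j k => (Vᴴ * U) j k * ((r k / (s j + t * r k) : ℝ) : ℂ))) * Uᴴ := by
    intro t
    rw [modularResolvent, Matrix.mul_smul, Matrix.smul_mul]
  rw [tendsto_congr e']
  have hcont : Continuous fun N : Matrix n n ℂ => V * N * Uᴴ := by fun_prop
  refine (hcont.tendsto (Vᴴ * U * diagonal (fun k => if r k = 0 then (0 : ℂ) else 1))).comp ?_
  refine tendsto_pi_nhds.2 fun j => tendsto_pi_nhds.2 fun k => ?_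
  simp only [Matrix.smul_apply, of_apply, mul_diagonal, smul_eq_mul]
  rcases (hr k).eq_or_lt with h | h
  · simp [← h]
  · have h1 : Tendsto (fun t : ℝ => s j / t + r k) atTop (𝓝 (r k)) := by
      simpa using (tendsto_const_nhds.div_atTop tendsto_id).add_const (r k)
    have h2 : Tendsto (fun t : ℝ => r k / (s j / t + r k)) atTop (𝓝 1) := by
      have := (tendsto_const_nhds (x := r k)).div h1 h.ne'
      rwa [div_self h.ne'] at this
    have h3 := ((Complex.continuous_ofReal.tendsto _).comp h2).const_mul ((Vᴴ * U) j k)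
    simp only [h.ne', if_false, Complex.ofReal_one] at h3 ⊢
    refine h3.congr' ?_
    filter_upwards [eventually_gt_atTop 0] with t ht
    have : r k / (s j / t + r k) = t * (r k / (s j + t * r k)) := by
      rw [← mul_div_assoc, div_eq_div_iff_comm]
      rw [show s j + t * r k = t * (s j / t + r k) by field_simp]
      field_simp
    simp only [Function.comp, this]
    push_cast
    ring

theorem IsDiagonalization.isSupportProj (hρ : IsDiagonalization ρ U r) :
    IsSupportProj ρ (U * diagonal (fun k => if r k = 0 then (0 : ℂ) else 1) * Uᴴ) := by
  have hU : ∀ w : n → ℂ, U.mulVec w = 0 ↔ w = 0 := fun w =>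
    ⟨fun h => by
      rw [← one_mulVec w, ← hρ.conjTranspose_mul_self, ← mulVec_mulVec, h, mulVec_zero],
      fun h => by rw [h, mulVec_zero]⟩
  refine ⟨?_, ?_, fun v => ?_⟩
  · rw [IsHermitian, conjTranspose_mul, conjTranspose_mul, conjTranspose_conjTranspose,
      diagonal_conjTranspose, Matrix.mul_assoc]
    congr 3
    ext k
    by_cases h : r k = 0 <;> simp [h]
  · simp only [Matrix.mul_assoc]
    rw [← Matrix.mul_assoc Uᴴ U, hρ.conjTranspose_mul_self, Matrix.one_mul,
      ← Matrix.mul_assoc (diagonal _) (diagonal _), diagonal_mul_diagonal]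
    congr 3
    ext k
    by_cases h : r k = 0 <;> simp [h]
  · conv_lhs => rw [hρ.eq]
    simp only [← mulVec_mulVec, hU]
    constructor <;> intro h <;> ext k <;> have := congrFun h k <;>
      by_cases hk : r k = 0 <;> simp_all [mulVec_diagonal]

end Resolvent

section Marginal

variable {A B C : Type*} [Fintype A] [Fintype B] [Fintype C]

theorem trace_one_kronecker_mul [DecidableEq A] (Y : Matrix (B × C) (B × C) ℂ)
    (τ : Matrix (A × B × C) (A × B × C) ℂ) :
    (((1 : Matrix A A ℂ) ⊗ₖ Y) * τ).trace = (Y * margBC τ).trace := by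
  simp only [trace, diag_apply, mul_apply, margBC, of_apply, kronecker_apply,
    Fintype.sum_prod_type (α₁ := A), Matrix.one_apply, ite_mul, one_mul, zero_mul,
    Finset.mul_sum]
  rw [Finset.sum_comm]
  refine Finset.sum_congr rfl fun p _ => ?_
  rw [Finset.sum_comm (γ := B × C)]
  refine Finset.sum_congr rfl fun a _ => ?_
  rw [Finset.sum_eq_single a]
  · simp
  · intro b _ hb
    simp [hb.symm]
  · simp

theorem margBC_posSemidef {τ : Matrix (A × B × C) (A × B × C) ℂ} (h : τ.PosSemidef) :
    (margBC τ).PosSemidef := by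
  have : margBC τ = ∑ a : A, τ.submatrix (fun p => (a, p)) (fun p => (a, p)) := by
    ext p q
    simp [margBC, Matrix.sum_apply]
  rw [this]
  exact posSemidef_sum _ fun a _ => h.submatrix _

theorem margAB_posSemidef {τ : Matrix (A × B × C) (A × B × C) ℂ} (h : τ.PosSemidef) :
    (margAB τ).PosSemidef := by
  have : margAB τ = ∑ c : C, τ.submatrix (fun p => (p.1, p.2, c)) (fun p => (p.1, p.2, c)) := by
    ext p q
    simp [margAB, Matrix.sum_apply]
  rw [this]
  exact posSemidef_sum _ fun a _ => h.submatrix _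

variable [DecidableEq A] {ρ σ X : Matrix (A × B × C) (A × B × C) ℂ}
  {Y : Matrix (B × C) (B × C) ℂ} {t : ℝ}

theorem trace_variational_gap (hρ : ρ.IsHermitian) (hσ : σ.IsHermitian)
    (hX : σ * X + (t : ℂ) • (X * ρ) = ρ)
    (hY : margBC σ * Y + (t : ℂ) • (Y * margBC ρ) = margBC ρ) :
    ((X - 1 ⊗ₖ Y)ᴴ * σ * (X - 1 ⊗ₖ Y)).trace
        + (t : ℂ) * ((X - 1 ⊗ₖ Y) * ρ * (X - 1 ⊗ₖ Y)ᴴ).trace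
      = (Xᴴ * ρ).trace - (Yᴴ * margBC ρ).trace := by
  set Z : Matrix (A × B × C) (A × B × C) ℂ := 1 ⊗ₖ Y with hZ
  have hZh : Zᴴ = 1 ⊗ₖ Yᴴ := by rw [hZ, conjTranspose_kronecker, conjTranspose_one]
  have ht : star (t : ℂ) = t := Complex.conj_ofReal t
  have t1 : (Zᴴ * ρ).trace = (Yᴴ * margBC ρ).trace := by rw [hZh, trace_one_kronecker_mul]
  have t2 : (Zᴴ * (σ * Z)).trace + (t : ℂ) * (Zᴴ * (Z * ρ)).trace
      = (Yᴴ * margBC ρ).trace := by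
    have a1 : (Zᴴ * (σ * Z)).trace = (Yᴴ * (margBC σ * Y)).trace := by
      rw [← Matrix.mul_assoc, trace_mul_comm, ← Matrix.mul_assoc, hZh, hZ, ← mul_kronecker_mul,
        Matrix.one_mul, trace_one_kronecker_mul, ← Matrix.mul_assoc, trace_mul_comm (Yᴴ * _),
        Matrix.mul_assoc]
    have a2 : (Zᴴ * (Z * ρ)).trace = (Yᴴ * (Y * margBC ρ)).trace := by
      rw [← Matrix.mul_assoc, hZh, hZ, ← mul_kronecker_mul, Matrix.one_mul,
        trace_one_kronecker_mul, Matrix.mul_assoc]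
    rw [a1, a2]
    conv_rhs => rw [← hY]
    simp [Matrix.mul_add]
  have t3 : (Zᴴ * (σ * X)).trace + (t : ℂ) * (Zᴴ * (X * ρ)).trace = (Zᴴ * ρ).trace := by
    conv_rhs => rw [← hX]
    simp [Matrix.mul_add]
  have t4 : (Xᴴ * (σ * X)).trace + (t : ℂ) * (Xᴴ * (X * ρ)).trace = (Xᴴ * ρ).trace := by
    conv_rhs => rw [← hX]
    simp [Matrix.mul_add]
  have s1 : (Xᴴ * (σ * Z)).trace = star (Zᴴ * (σ * X)).trace := by
    rw [← trace_conjTranspose, conjTranspose_mul, conjTranspose_mul, conjTranspose_conjTranspose,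
      hσ.eq, Matrix.mul_assoc]
  have s2 : (Xᴴ * (Z * ρ)).trace = star (Zᴴ * (X * ρ)).trace := by
    rw [← trace_conjTranspose, conjTranspose_mul, conjTranspose_mul, conjTranspose_conjTranspose,
      hρ.eq, Matrix.mul_assoc, trace_mul_comm ρ, Matrix.mul_assoc]
  have s3 : star ((Yᴴ * margBC ρ).trace) = (Yᴴ * margBC ρ).trace := by
    rw [← t2, star_add, star_mul', ht, ← trace_conjTranspose, ← trace_conjTranspose]
    congr 2
    · simp only [conjTranspose_mul, conjTranspose_conjTranspose, hσ.eq, Matrix.mul_assoc]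
    · simp only [conjTranspose_mul, conjTranspose_conjTranspose, hρ.eq]
      rw [Matrix.mul_assoc, trace_mul_comm, Matrix.mul_assoc]
  have t5 : (Xᴴ * (σ * Z)).trace + (t : ℂ) * (Xᴴ * (Z * ρ)).trace = (Yᴴ * margBC ρ).trace := by
    rw [s1, s2, ← s3, ← t1, ← t3, star_add, star_mul', ht]
  have e1 : ((X - Z)ᴴ * σ * (X - Z)).trace = (Xᴴ * (σ * X)).trace - (Xᴴ * (σ * Z)).trace
      - (Zᴴ * (σ * X)).trace + (Zᴴ * (σ * Z)).trace := by
    simp only [conjTranspose_sub, Matrix.sub_mul, Matrix.mul_sub, trace_sub, Matrix.mul_assoc]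
    ring
  have e2 : ((X - Z) * ρ * (X - Z)ᴴ).trace = (Xᴴ * (X * ρ)).trace - (Xᴴ * (Z * ρ)).trace
      - (Zᴴ * (X * ρ)).trace + (Zᴴ * (Z * ρ)).trace := by
    rw [trace_mul_comm]
    simp only [conjTranspose_sub, Matrix.sub_mul, Matrix.mul_sub, trace_sub]
    ring
  rw [e1, e2]
  linear_combination t4 - t5 - t3 + t2 - t1

theorem Matrix.PosSemidef.mul_eq_zero_of_trace {n m : Type*} [Fintype n] [Fintype m]
    {σ : Matrix n n ℂ} (hσ : σ.PosSemidef) {D : Matrix n m ℂ}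
    (h : (Dᴴ * σ * D).trace = 0) : σ * D = 0 := by
  have h0 := (hσ.conjTranspose_mul_mul_same D).trace_eq_zero_iff.1 h
  ext i j
  have : star (D.col j) ⬝ᵥ σ.mulVec (D.col j) = 0 := by
    have h1 := congrFun (congrFun h0 j) j
    rw [Matrix.mul_assoc] at h1
    exact h1
  exact congrFun ((hσ.dotProduct_mulVec_zero_iff _).1 this) i

theorem trace_modular_le (hρ : ρ.PosSemidef) (hσ : σ.PosSemidef) (ht : 0 ≤ t)
    (hX : σ * X + (t : ℂ) • (X * ρ) = ρ)
    (hY : margBC σ * Y + (t : ℂ) • (Y * margBC ρ) = margBC ρ) :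
    (Yᴴ * margBC ρ).trace ≤ (Xᴴ * ρ).trace := by
  rw [← sub_nonneg, ← trace_variational_gap hρ.isHermitian hσ.isHermitian hX hY]
  exact add_nonneg (hσ.conjTranspose_mul_mul_same _).trace_nonneg
    (mul_nonneg (by exact_mod_cast ht) (hρ.mul_mul_conjTranspose_same _).trace_nonneg)

theorem mulVec_eq_zero_of_trace_modular_eq (hρ : ρ.PosSemidef) (hσ : σ.PosSemidef) (ht : 0 ≤ t)
    (hX : σ * X + (t : ℂ) • (X * ρ) = ρ)
    (hY : margBC σ * Y + (t : ℂ) • (Y * margBC ρ) = margBC ρ)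
    (h : (Xᴴ * ρ).trace = (Yᴴ * margBC ρ).trace) {φ : A × B × C → ℂ} (hφ : ρ.mulVec φ = 0) :
    (σ * (1 ⊗ₖ Y)).mulVec φ = 0 := by
  have gap := trace_variational_gap hρ.isHermitian hσ.isHermitian hX hY
  rw [h, sub_self] at gap
  have h0 := ((add_eq_zero_iff_of_nonneg (hσ.conjTranspose_mul_mul_same _).trace_nonneg
    (mul_nonneg (by exact_mod_cast ht) (hρ.mul_mul_conjTranspose_same _).trace_nonneg)).1 gap).1
  have h1 := hσ.mul_eq_zero_of_trace h0
  rw [Matrix.mul_sub, sub_eq_zero] at h1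
  have h2 : (σ * X).mulVec φ = 0 := by
    have := congrArg (fun M => M.mulVec φ) hX
    simpa [add_mulVec, smul_mulVec, ← mulVec_mulVec, hφ] using this
  rw [← h1, h2]

end Marginal

theorem IsDiagonalization.trace_eq {n : Type*} [Fintype n] [DecidableEq n] {ρ U : Matrix n n ℂ}
    {r : n → ℝ} (h : IsDiagonalization ρ U r) : ρ.trace = ((∑ k, r k : ℝ) : ℂ) := by
  rw [h.eq, trace_mul_comm, ← Matrix.mul_assoc, h.conjTranspose_mul_self, Matrix.one_mul,
    trace_diagonal]
  push_cast
  rfl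

theorem margBC_trace {A B C : Type*} [Fintype A] [Fintype B] [Fintype C]
    (τ : Matrix (A × B × C) (A × B × C) ℂ) : (margBC τ).trace = τ.trace := by
  simp only [trace, diag_apply, margBC, of_apply, Fintype.sum_prod_type (α₁ := A)]
  exact Finset.sum_comm

section Equality

variable {A B C : Type*} [Fintype A] [DecidableEq A] [Fintype B] [DecidableEq B]
    [Fintype C] [DecidableEq C] {ρ σ U V : Matrix (A × B × C) (A × B × C) ℂ}
    {r s : A × B × C → ℝ} {U' V' : Matrix (B × C) (B × C) ℂ} {r' s' : B × C → ℝ}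

open Filter Topology in
/-- If the relative entropy does not decrease under the partial trace, then all the quadratic
divergences in its integral representation are preserved. -/
theorem trace_modularResolvent_eq_of_relEntropy_eq (hρ : ρ.PosSemidef) (hσ : σ.PosSemidef)
    (dρ : IsDiagonalization ρ U r) (dσ : IsDiagonalization σ V s)
    (dρ' : IsDiagonalization (margBC ρ) U' r') (dσ' : IsDiagonalization (margBC σ) V' s')
    (hr : ∀ k, 0 ≤ r k) (hs : ∀ k, 0 ≤ s k) (hr' : ∀ k, 0 ≤ r' k) (hs' : ∀ k, 0 ≤ s' k)
    (hker : ∀ v, σ.mulVec v = 0 → ρ.mulVec v = 0)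
    (hker' : ∀ v, (margBC σ).mulVec v = 0 → (margBC ρ).mulVec v = 0)
    (h : ∑ k, r k * Real.log (r k) - logOverlap V s U r 0
      = ∑ k, r' k * Real.log (r' k) - logOverlap V' s' U' r' 0) {t : ℝ} (ht : 0 < t) :
    ((modularResolvent V s U r t)ᴴ * ρ).trace
      = ((modularResolvent V' s' U' r' t)ᴴ * margBC ρ).trace := by
  set f : ℝ → ℝ := fun x => logOverlap V s U r x - logOverlap V' s' U' r' x with hf
  have hd : ∀ x, 0 < x → HasDerivAt f _ x := fun x hx =>
    (hasDerivAt_logOverlap (V := V) (U := U) hr hs hx).sub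
      (hasDerivAt_logOverlap (V := V') (U := U') hr' hs' hx)
  have hmono : MonotoneOn f (Set.Ici 0) := by
    refine monotoneOn_of_deriv_nonneg (convex_Ici 0)
      ((continuousOn_logOverlap dρ dσ hker hr hs).sub
        (continuousOn_logOverlap dρ' dσ' hker' hr' hs')) ?_ ?_
    · intro x hx
      rw [interior_Ici] at hx
      exact (hd x hx).differentiableAt.differentiableWithinAt
    · intro x hx
      rw [interior_Ici] at hx
      rw [(hd x hx).deriv, sub_nonneg]
      have := trace_modular_le hρ hσ (le_of_lt hx) (modularResolvent_spec dρ dσ hr hs hx)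
        (modularResolvent_spec dρ' dσ' hr' hs' hx)
      rw [trace_modularResolvent dρ, trace_modularResolvent dρ'] at this
      exact_mod_cast this
  have hsum : ∑ k, r k = ∑ k, r' k := by
    have := margBC_trace ρ
    rw [dρ.trace_eq, dρ'.trace_eq] at this
    exact_mod_cast this.symm
  have hlim : Tendsto f atTop (𝓝 (f 0)) := by
    have h1 := (tendsto_logOverlap dρ dσ hr).sub (tendsto_logOverlap dρ' dσ' hr')
    have h2 : f 0 = ∑ k, r k * Real.log (r k) - ∑ k, r' k * Real.log (r' k) := by
      simp only [hf]
      linear_combination -h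
    rw [h2]
    refine h1.congr fun x => ?_
    rw [hsum]
    simp only [hf]
    ring
  have hconst : ∀ x, 0 ≤ x → f x = f 0 := by
    intro x hx
    refine le_antisymm (ge_of_tendsto hlim ?_) (hmono Set.self_mem_Ici hx hx)
    filter_upwards [eventually_ge_atTop x] with y hy
    exact hmono hx (hx.trans hy) hy
  have hzero : HasDerivAt f 0 t := by
    refine (hasDerivAt_const t (f 0)).congr_of_eventuallyEq ?_
    filter_upwards [lt_mem_nhds ht] with x hx
    exact hconst x hx.le
  have := (hd t ht).unique hzero
  rw [trace_modularResolvent dρ, trace_modularResolvent dρ', sub_eq_zero.1 this]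

open Filter Topology in
theorem mulVec_supportProj_eq_zero_of_relEntropy_eq (hρ : ρ.PosSemidef) (hσ : σ.PosSemidef)
    (dρ : IsDiagonalization ρ U r) (dσ : IsDiagonalization σ V s)
    (dρ' : IsDiagonalization (margBC ρ) U' r') (dσ' : IsDiagonalization (margBC σ) V' s')
    (hr : ∀ k, 0 ≤ r k) (hs : ∀ k, 0 ≤ s k) (hr' : ∀ k, 0 ≤ r' k) (hs' : ∀ k, 0 ≤ s' k)
    (hker : ∀ v, σ.mulVec v = 0 → ρ.mulVec v = 0)
    (hker' : ∀ v, (margBC σ).mulVec v = 0 → (margBC ρ).mulVec v = 0)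
    (h : ∑ k, r k * Real.log (r k) - logOverlap V s U r 0
      = ∑ k, r' k * Real.log (r' k) - logOverlap V' s' U' r' 0)
    {φ : A × B × C → ℂ} (hφ : ρ.mulVec φ = 0) :
    (σ * ((1 : Matrix A A ℂ) ⊗ₖ
      (U' * diagonal (fun k => if r' k = 0 then (0 : ℂ) else 1) * U'ᴴ))).mulVec φ = 0 := by
  have hcont : Continuous fun Y : Matrix (B × C) (B × C) ℂ =>
      (σ * ((1 : Matrix A A ℂ) ⊗ₖ Y)).mulVec φ := by
    have : Continuous fun Y : Matrix (B × C) (B × C) ℂ => (1 : Matrix A A ℂ) ⊗ₖ Y := by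
      refine continuous_matrix fun i j => ?_
      change Continuous fun Y : Matrix (B × C) (B × C) ℂ => (1 : Matrix A A ℂ) i.1 j.1 * Y i.2 j.2
      fun_prop
    fun_prop
  refine tendsto_nhds_unique ((hcont.tendsto _).comp (tendsto_smul_modularResolvent dσ' hr'))
    (tendsto_const_nhds.congr' ?_)
  filter_upwards [eventually_gt_atTop 0] with t ht
  have := mulVec_eq_zero_of_trace_modular_eq hρ hσ ht.le (modularResolvent_spec dρ dσ hr hs ht)
    (modularResolvent_spec dρ' dσ' hr' hs' ht)
    (trace_modularResolvent_eq_of_relEntropy_eq hρ hσ dρ dσ dρ' dσ' hr hs hr' hs' hker hker' h ht)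
    hφ
  simp only [Function.comp, kronecker_smul, Matrix.mul_smul, smul_mulVec, this, smul_zero]

end Equality

section Amplify

variable {X Y N : Type*} [DecidableEq Y]

/-- The operator `M ⊗ 1` transported along an identification `X × Y ≃ N`. -/
def amplify (e : X × Y ≃ N) (M : Matrix X X ℂ) : Matrix N N ℂ :=
  (M ⊗ₖ (1 : Matrix Y Y ℂ)).submatrix e.symm e.symm

/-- The partial trace over `Y` along an identification `X × Y ≃ N`. -/
def partialTrace [Fintype Y] (e : X × Y ≃ N) (τ : Matrix N N ℂ) : Matrix X X ℂ :=
  Matrix.of fun x x' => ∑ y, τ (e (x, y)) (e (x', y))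

theorem amplify_apply (e : X × Y ≃ N) (M : Matrix X X ℂ) (x x' : X) (y y' : Y) :
    amplify e M (e (x, y)) (e (x', y')) = if y = y' then M x x' else 0 := by
  simp [amplify, Matrix.one_apply]

theorem amplify_conjTranspose (e : X × Y ≃ N) (M : Matrix X X ℂ) :
    (amplify e M)ᴴ = amplify e Mᴴ := by
  rw [amplify, amplify, conjTranspose_submatrix, conjTranspose_kronecker, conjTranspose_one]

variable [Fintype X] [Fintype Y] [Fintype N]

theorem amplify_mul (e : X × Y ≃ N) (M M' : Matrix X X ℂ) :
    amplify e (M * M') = amplify e M * amplify e M' := by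
  rw [amplify, amplify, amplify, submatrix_mul_equiv, ← mul_kronecker_mul, Matrix.one_mul]

theorem amplify_mulVec (e : X × Y ≃ N) (M : Matrix X X ℂ) (v : N → ℂ) (x : X) (y : Y) :
    (amplify e M).mulVec v (e (x, y)) = M.mulVec (fun x' => v (e (x', y))) x := by
  simp only [mulVec, dotProduct]
  rw [← e.sum_comp, Fintype.sum_prod_type]
  simp [amplify_apply]

theorem amplify_mulVec_eq_zero_iff (e : X × Y ≃ N) (M : Matrix X X ℂ) (v : N → ℂ) :
    (amplify e M).mulVec v = 0 ↔ ∀ y, M.mulVec (fun x => v (e (x, y))) = 0 := by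
  constructor
  · intro h y
    ext x
    rw [← amplify_mulVec, h]
    rfl
  · intro h
    ext i
    obtain ⟨⟨x, y⟩, rfl⟩ := e.surjective i
    rw [amplify_mulVec, h]
    rfl

theorem IsSupportProj.amplify {ρ P : Matrix X X ℂ} (h : IsSupportProj ρ P) (e : X × Y ≃ N) :
    IsSupportProj (amplify e ρ) (amplify e P) := by
  refine ⟨?_, ?_, fun v => ?_⟩
  · rw [IsHermitian, amplify_conjTranspose, h.1.eq]
  · rw [← amplify_mul, h.2.1]
  · simp only [amplify_mulVec_eq_zero_iff, h.2.2]

theorem Matrix.PosSemidef.amplify {ρ : Matrix X X ℂ} (h : ρ.PosSemidef) (e : X × Y ≃ N) :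
    (amplify e ρ).PosSemidef :=
  (h.kronecker PosSemidef.one).submatrix _

open scoped MatrixOrder in
theorem mulVec_eq_zero_of_amplify_partialTrace {τ : Matrix N N ℂ} (hτ : τ.PosSemidef)
    (e : X × Y ≃ N) {v : N → ℂ} (hv : (amplify e (partialTrace e τ)).mulVec v = 0) :
    τ.mulVec v = 0 := by
  classical
  obtain ⟨K, rfl⟩ := CStarAlgebra.nonneg_iff_eq_star_mul_self.mp hτ.nonneg
  rw [star_eq_conjTranspose] at *
  rw [amplify_mulVec_eq_zero_iff] at hv
  set L : Y → Matrix N X ℂ := fun y => K.submatrix id fun x => e (x, y)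
  have hsum : partialTrace e (Kᴴ * K) = ∑ y, (L y)ᴴ * L y := by
    ext x x'
    simp [partialTrace, Matrix.sum_apply, L, mul_apply]
  have hL : ∀ y, (L y).mulVec (fun x => v (e (x, y))) = 0 := by
    intro y
    set u : X → ℂ := fun x => v (e (x, y))
    have h1 : ∑ y', star u ⬝ᵥ ((L y')ᴴ * L y').mulVec u = 0 := by
      rw [← dotProduct_sum, ← sum_mulVec, ← hsum, hv y, dotProduct_zero]
    have h2 := (Finset.sum_eq_zero_iff_of_nonneg fun y' _ =>
      (posSemidef_conjTranspose_mul_self (L y')).dotProduct_mulVec_nonneg u).1 h1 y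
      (Finset.mem_univ y)
    rw [(posSemidef_conjTranspose_mul_self (L y)).dotProduct_mulVec_zero_iff] at h2
    exact (conjTranspose_mul_self_mulVec_eq_zero (L y) u).1 h2
  have hK : K.mulVec v = 0 := by
    ext i
    have : K.mulVec v i = ∑ y, (L y).mulVec (fun x => v (e (x, y))) i := by
      simp only [mulVec, dotProduct, L, submatrix_apply, id]
      rw [← e.sum_comp, Fintype.sum_prod_type, Finset.sum_comm]
    simp [this, hL]
  rw [← mulVec_mulVec, hK, mulVec_zero]

theorem partialTrace_amplify_mul (e : X × Y ≃ N) (M : Matrix X X ℂ) (τ : Matrix N N ℂ) :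
    partialTrace e (amplify e M * τ) = M * partialTrace e τ := by
  ext x x'
  simp only [partialTrace, of_apply, mul_apply, ← e.sum_comp, Fintype.sum_prod_type,
    amplify_apply, ite_mul, zero_mul, Finset.sum_ite_eq, Finset.mem_univ, if_true, Finset.mul_sum]
  exact Finset.sum_comm

theorem partialTrace_mul_amplify (e : X × Y ≃ N) (M : Matrix X X ℂ) (τ : Matrix N N ℂ) :
    partialTrace e (τ * amplify e M) = partialTrace e τ * M := by
  ext x x'
  simp only [partialTrace, of_apply, mul_apply, ← e.sum_comp, Fintype.sum_prod_type,
    amplify_apply, mul_ite, mul_zero, Finset.sum_ite_eq', Finset.mem_univ, if_true,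
    Finset.sum_mul]
  exact Finset.sum_comm

variable [DecidableEq X] [DecidableEq N]

theorem amplify_one (e : X × Y ≃ N) : amplify e 1 = 1 := by
  rw [amplify, one_kronecker_one, submatrix_one_equiv]

theorem IsDiagonalization.amplify {ρ U : Matrix X X ℂ} {r : X → ℝ}
    (h : IsDiagonalization ρ U r) (e : X × Y ≃ N) :
    IsDiagonalization (amplify e ρ) (amplify e U) (fun i => r (e.symm i).1) where
  conjTranspose_mul_self := by
    rw [amplify_conjTranspose, ← amplify_mul, h.conjTranspose_mul_self, amplify_one]
  mul_conjTranspose_self := by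
    rw [amplify_conjTranspose, ← amplify_mul, h.mul_conjTranspose_self, amplify_one]
  eq := by
    have : diagonal (fun i => (r (e.symm i).1 : ℂ))
        = _root_.amplify e (diagonal fun x => (r x : ℂ)) := by
      ext i j
      obtain ⟨⟨x, y⟩, rfl⟩ := e.surjective i
      obtain ⟨⟨x', y'⟩, rfl⟩ := e.surjective j
      by_cases hx : x = x' <;> by_cases hy : y = y' <;>
        simp [amplify_apply, hx, hy]
    rw [this, amplify_conjTranspose, ← amplify_mul, ← amplify_mul, ← h.eq]

/-- `Tr τ log (τ_X ⊗ 1) = Tr τ_X log τ_X`. -/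
theorem logOverlap_amplify_zero (e : X × Y ≃ N) {τ U : Matrix N N ℂ} {r : N → ℝ}
    {V : Matrix X X ℂ} {s : X → ℝ} (hτ : IsDiagonalization τ U r)
    (hX : IsDiagonalization (partialTrace e τ) V s) :
    logOverlap (amplify e V) (fun i => s (e.symm i).1) U r 0 = ∑ x, s x * Real.log (s x) := by
  set W := amplify e V
  have h1 : ∀ j, (((∑ k, Complex.normSq ((Wᴴ * U) j k) * r k : ℝ)) : ℂ) = (Wᴴ * τ * W) j j := by
    intro j
    have : Wᴴ * τ * W = Wᴴ * U * diagonal (fun i => (r i : ℂ)) * (Wᴴ * U)ᴴ := by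
      rw [hτ.eq]
      simp only [conjTranspose_mul, conjTranspose_conjTranspose, Matrix.mul_assoc]
    rw [this, mul_apply]
    push_cast
    refine Finset.sum_congr rfl fun k _ => ?_
    rw [mul_diagonal, conjTranspose_apply, Complex.normSq_eq_conj_mul_self, Complex.star_def]
    ring
  have h2 : ∀ x, ∑ y, ∑ k, Complex.normSq ((Wᴴ * U) (e (x, y)) k) * r k = s x := by
    intro x
    have h3 : partialTrace e (Wᴴ * τ * W) = diagonal fun x => (s x : ℂ) := by
      rw [partialTrace_mul_amplify, amplify_conjTranspose, partialTrace_amplify_mul, hX.eq]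
      simp only [Matrix.mul_assoc]
      rw [hX.conjTranspose_mul_self, Matrix.mul_one, ← Matrix.mul_assoc,
        hX.conjTranspose_mul_self, Matrix.one_mul]
    have h4 := congrFun (congrFun h3 x) x
    rw [diagonal_apply_eq] at h4
    simp only [partialTrace, of_apply, ← h1] at h4
    exact_mod_cast h4
  simp only [logOverlap, zero_mul, add_zero]
  rw [← e.sum_comp, Fintype.sum_prod_type]
  refine Finset.sum_congr rfl fun x _ => ?_
  rw [← h2 x, Finset.sum_mul, h2 x]
  refine Finset.sum_congr rfl fun y _ => ?_
  rw [Finset.sum_mul, Equiv.symm_apply_apply]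
  exact Finset.sum_congr rfl fun k _ => by ring

end Amplify

section SupportProj

variable {n : Type*} [Fintype n] [DecidableEq n] {ρ σ P Q : Matrix n n ℂ}

theorem IsSupportProj.mul_eq_right (hσ : IsSupportProj σ P) (hρ : IsSupportProj ρ Q)
    (hker : ∀ v, σ.mulVec v = 0 → ρ.mulVec v = 0) : P * Q = Q := by
  have h : Q * (1 - P) = 0 := by
    refine ext_of_mulVec_single fun i => ?_
    rw [← mulVec_mulVec, zero_mulVec]
    refine (hρ.2.2 _).1 (hker _ ((hσ.2.2 _).2 ?_))
    rw [mulVec_mulVec, Matrix.mul_sub, hσ.2.1, Matrix.mul_one, sub_self, zero_mulVec]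
  rw [Matrix.mul_sub, Matrix.mul_one, sub_eq_zero] at h
  have := congrArg conjTranspose h
  rw [conjTranspose_mul, hσ.1.eq, hρ.1.eq] at this
  exact this.symm

theorem IsSupportProj.unique (hP : IsSupportProj ρ P) (hQ : IsSupportProj ρ Q) : P = Q := by
  have h1 := hP.mul_eq_right hQ fun _ h => h
  have h2 := congrArg conjTranspose (hQ.mul_eq_right hP fun _ h => h)
  rw [conjTranspose_mul, hP.1.eq, hQ.1.eq] at h2
  rw [← h2, h1]

end SupportProj

theorem Matrix.IsHermitian.vNEntropy_eq {n : Type*} [Fintype n] [DecidableEq n]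
    {ρ : Matrix n n ℂ} (h : ρ.IsHermitian) :
    vNEntropy ρ = -∑ i, h.eigenvalues i * Real.log (h.eigenvalues i) :=
  dif_pos h

section Markov

variable {A B C : Type*} [Fintype A] [DecidableEq A] [Fintype B] [DecidableEq B]
    [Fintype C] [DecidableEq C]

theorem one_kronecker_eq_amplify (M : Matrix (B × C) (B × C) ℂ) :
    (1 : Matrix A A ℂ) ⊗ₖ M = amplify (Equiv.prodComm (B × C) A) M := by
  ext ⟨a, p⟩ ⟨a', p'⟩
  simp [amplify, mul_comm]

theorem margBC_amplify_margAB (ρ : Matrix (A × B × C) (A × B × C) ℂ) :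
    margBC (amplify (Equiv.prodAssoc A B C) (margAB ρ))
      = amplify (Equiv.refl (B × C)) (margB ρ) := by
  ext i j
  simp [margBC, amplify, margAB, margB, Finset.sum_mul]

theorem margB_eq_partialTrace (ρ : Matrix (A × B × C) (A × B × C) ℂ) :
    margB ρ = partialTrace (Equiv.refl (B × C)) (margBC ρ) := by
  ext b b'
  exact Finset.sum_comm

theorem margB_posSemidef {ρ : Matrix (A × B × C) (A × B × C) ℂ} (h : ρ.PosSemidef) :
    (margB ρ).PosSemidef := by
  have : margB ρ = ∑ a : A, ∑ c : C, ρ.submatrix (fun b => (a, b, c)) (fun b => (a, b, c)) := by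
    ext p q
    simp [margB, Matrix.sum_apply]
  rw [this]
  exact posSemidef_sum _ fun a _ => posSemidef_sum _ fun c _ => h.submatrix _

theorem margAB_one_kronecker_margBC_supportProj_mulVec_eq_zero
    {ρ : Matrix (A × B × C) (A × B × C) ℂ} (hρ : ρ.PosSemidef) (hMarkov : CMI ρ = 0)
    {PBC : Matrix (B × C) (B × C) ℂ} (hPBC : IsSupportProj (margBC ρ) PBC)
    {φ : A × B × C → ℂ} (hφ : ρ.mulVec φ = 0) :
    (amplify (Equiv.prodAssoc A B C) (margAB ρ) * ((1 : Matrix A A ℂ) ⊗ₖ PBC)).mulVec φ = 0 := by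
  have pAB := margAB_posSemidef hρ
  have pBC := margBC_posSemidef hρ
  have pB := margB_posSemidef hρ
  have dAB := pAB.isHermitian.isDiagonalization
  have dBC := pBC.isHermitian.isDiagonalization
  have dB := pB.isHermitian.isDiagonalization
  have d := hρ.isHermitian.isDiagonalization
  have dσ := dAB.amplify (Equiv.prodAssoc A B C)
  have dσ' := dB.amplify (Equiv.refl (B × C))
  rw [← margBC_amplify_margAB] at dσ'
  rw [hPBC.unique dBC.isSupportProj]
  refine mulVec_supportProj_eq_zero_of_relEntropy_eq hρ (pAB.amplify _) d dσ dBC dσ'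
    hρ.eigenvalues_nonneg (fun _ => pAB.eigenvalues_nonneg _) pBC.eigenvalues_nonneg
    (fun _ => pB.eigenvalues_nonneg _)
    (fun v hv => mulVec_eq_zero_of_amplify_partialTrace hρ _ hv) (fun v hv => ?_) ?_ hφ
  · rw [margBC_amplify_margAB, margB_eq_partialTrace] at hv
    exact mulVec_eq_zero_of_amplify_partialTrace pBC _ hv
  · have e1 := logOverlap_amplify_zero (Equiv.prodAssoc A B C) d dAB
    have e2 := logOverlap_amplify_zero (Equiv.refl (B × C)) dBC
      (by rw [← margB_eq_partialTrace]; exact dB)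
    rw [e1, e2]
    rw [CMI, pAB.isHermitian.vNEntropy_eq, pBC.isHermitian.vNEntropy_eq,
      pB.isHermitian.vNEntropy_eq, hρ.isHermitian.vNEntropy_eq] at hMarkov
    linear_combination hMarkov

end Markov

/-- For a quantum Markov chain `ρ_ABC` (`I(A:C|B) = 0`), the kernel of
`(1 - P_AB ⊗ 1_C) + (1 - 1_A ⊗ P_BC)` equals the range of `P_ABC`: a vector `ψ` is fixed
by both `P_AB ⊗ 1_C` and `1_A ⊗ P_BC` if and only if it is fixed by `P_ABC`. -/
theorem fixed_by_both_marginal_projs_iff_in_support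
    {A B C : Type*} [Fintype A] [DecidableEq A] [Fintype B] [DecidableEq B]
    [Fintype C] [DecidableEq C]
    (ρ : Matrix (A × B × C) (A × B × C) ℂ) (hρ : IsDensityMatrix ρ)
    (hMarkov : CMI ρ = 0)
    (PAB : Matrix (A × B) (A × B) ℂ) (hPAB : IsSupportProj (margAB ρ) PAB)
    (PBC : Matrix (B × C) (B × C) ℂ) (hPBC : IsSupportProj (margBC ρ) PBC)
    (PABC : Matrix (A × B × C) (A × B × C) ℂ) (hPABC : IsSupportProj ρ PABC) :
    ∀ ψ : A × B × C → ℂ,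
      ((Matrix.reindex (Equiv.prodAssoc A B C) (Equiv.prodAssoc A B C)
            (PAB ⊗ₖ (1 : Matrix C C ℂ))).mulVec ψ = ψ
        ∧ ((1 : Matrix A A ℂ) ⊗ₖ PBC).mulVec ψ = ψ)
      ↔ PABC.mulVec ψ = ψ := by
  intro ψ
  set S := Matrix.reindex (Equiv.prodAssoc A B C) (Equiv.prodAssoc A B C)
    (PAB ⊗ₖ (1 : Matrix C C ℂ)) with hS
  set T := (1 : Matrix A A ℂ) ⊗ₖ PBC with hT
  have hSproj : IsSupportProj (amplify (Equiv.prodAssoc A B C) (margAB ρ)) S := hPAB.amplify _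
  have hTproj : IsSupportProj (amplify (Equiv.prodComm (B × C) A) (margBC ρ)) T := by
    rw [hT, one_kronecker_eq_amplify]
    exact hPBC.amplify _
  constructor
  · rintro ⟨h1, h2⟩
    have h : S * T * (1 - PABC) = 0 := by
      refine ext_of_mulVec_single fun i => ?_
      rw [← mulVec_mulVec, ← mulVec_mulVec, zero_mulVec, ← hSproj.2.2, mulVec_mulVec]
      refine margAB_one_kronecker_margBC_supportProj_mulVec_eq_zero hρ.1 hMarkov hPBC
        ((hPABC.2.2 _).2 ?_)
      rw [mulVec_mulVec, Matrix.mul_sub, hPABC.2.1, Matrix.mul_one, sub_self, zero_mulVec]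
    rw [Matrix.mul_sub, Matrix.mul_one, sub_eq_zero] at h
    have h3 := congrArg conjTranspose h
    rw [conjTranspose_mul, conjTranspose_mul, conjTranspose_mul, hSproj.1.eq, hTproj.1.eq,
      hPABC.1.eq] at h3
    have h4 : (T * S).mulVec ψ = ψ := by rw [← mulVec_mulVec, h1, h2]
    rw [← h4, mulVec_mulVec, ← h3]
  · intro h
    have h1 := hSproj.mul_eq_right hPABC fun v hv =>
      mulVec_eq_zero_of_amplify_partialTrace hρ.1 _ hv
    have h2 := hTproj.mul_eq_right hPABC fun v hv =>
      mulVec_eq_zero_of_amplify_partialTrace hρ.1 _ hv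
    rw [← h, mulVec_mulVec, mulVec_mulVec, h1, h2]
    exact ⟨rfl, rfl⟩
end

section
/- Let ρ be a density matrix on H_C ⊗ H_B ⊗ H_{B'}. If S(C)_ρ + S(CB)_ρ − S(B)_ρ = 0, then S(C)_ρ + S(CBB')_ρ − S(BB')_ρ = 0. -/
open Matrix BigOperators
open scoped ComplexOrder

open scoped Kronecker

lemma vNEntropy_eq_sum_roots {n : Type*} [Fintype n] [DecidableEq n] {A : Matrix n n ℂ}
    (hA : A.IsHermitian) :
    vNEntropy A = (A.charpoly.roots.map fun z => Real.negMulLog z.re).sum := by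
  rw [vNEntropy, dif_pos hA, hA.roots_charpoly_eq_eigenvalues, Multiset.map_map,
    ← Finset.sum_neg_distrib]
  simp [Real.negMulLog]

lemma vNEntropy_transpose {n : Type*} [Fintype n] [DecidableEq n] {A : Matrix n n ℂ}
    (hA : A.IsHermitian) : vNEntropy Aᵀ = vNEntropy A := by
  rw [vNEntropy_eq_sum_roots hA, vNEntropy_eq_sum_roots hA.transpose, charpoly_transpose]

lemma vNEntropy_mul_conjTranspose {m n : Type*} [Fintype m] [DecidableEq m] [Fintype n]
    [DecidableEq n] (K : Matrix m n ℂ) : vNEntropy (K * Kᴴ) = vNEntropy (Kᴴ * K) := by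
  rw [vNEntropy_eq_sum_roots (isHermitian_mul_conjTranspose_self K),
    vNEntropy_eq_sum_roots (isHermitian_conjTranspose_mul_self K)]
  have h := congrArg (fun p => (p.roots.map fun z : ℂ => Real.negMulLog z.re).sum)
    (charpoly_mul_comm' K Kᴴ)
  have hX (k : ℕ) : (Polynomial.X ^ k : Polynomial ℂ) ≠ 0 := pow_ne_zero _ Polynomial.X_ne_zero
  simpa [Polynomial.roots_mul, hX, (charpoly_monic _).ne_zero, Multiset.map_nsmul,
    Multiset.sum_nsmul] using h

/-- The two reduced density matrices of a pure bipartite state have the same entropy. -/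
lemma vNEntropy_reduced_eq {m n : Type*} [Fintype m] [DecidableEq m] [Fintype n]
    [DecidableEq n] (K : Matrix m n ℂ) :
    vNEntropy (Matrix.of fun x x' => ∑ y, K x y * star (K x' y)) =
      vNEntropy (Matrix.of fun y y' => ∑ x, K x y * star (K x y')) := by
  have h₁ : (Matrix.of fun x x' => ∑ y, K x y * star (K x' y)) = K * Kᴴ := by
    ext; simp [mul_apply]
  have h₂ : (Matrix.of fun y y' => ∑ x, K x y * star (K x y')) = (Kᴴ * K)ᵀ := by
    ext; simp [mul_apply, mul_comm]
  rw [h₁, h₂, vNEntropy_transpose (isHermitian_conjTranspose_mul_self K),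
    vNEntropy_mul_conjTranspose]

lemma vNEntropy_unitary_conj_diagonal {n : Type*} [Fintype n] [DecidableEq n]
    {U : Matrix n n ℂ} (hU : Uᴴ * U = 1) (d : n → ℝ) :
    vNEntropy (U * diagonal (fun i => (d i : ℂ)) * Uᴴ) = ∑ i, Real.negMulLog (d i) := by
  have hD : (diagonal fun i => (d i : ℂ)).IsHermitian := by
    rw [isHermitian_diagonal_iff]
    intro i
    simp [isSelfAdjoint_iff]
  rw [vNEntropy_eq_sum_roots (isHermitian_mul_mul_conjTranspose U hD), charpoly_mul_comm,
    ← mul_assoc, hU, one_mul, charpoly_diagonal, Polynomial.roots_prod]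
  · simp
  · simp [Finset.prod_ne_zero_iff, Polynomial.X_sub_C_ne_zero]

lemma exists_unitary_diagonalization {n : Type*} [Fintype n] [DecidableEq n]
    {A : Matrix n n ℂ} (hA : A.IsHermitian) :
    ∃ (U : Matrix n n ℂ) (d : n → ℝ), Uᴴ * U = 1 ∧ U * Uᴴ = 1 ∧
      A = U * diagonal (fun i => (d i : ℂ)) * Uᴴ := by
  refine ⟨hA.eigenvectorUnitary, hA.eigenvalues, ?_, ?_, ?_⟩
  · exact Unitary.coe_star_mul_self hA.eigenvectorUnitary
  · exact Unitary.coe_mul_star_self hA.eigenvectorUnitary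
  · exact hA.spectral_theorem

lemma conjTranspose_conj_cancel {n : Type*} [Fintype n] [DecidableEq n] {U : Matrix n n ℂ}
    (hU : Uᴴ * U = 1) (D : Matrix n n ℂ) : Uᴴ * (U * D * Uᴴ) * U = D := by
  rw [← mul_assoc, ← mul_assoc, hU, one_mul, mul_assoc, hU, mul_one]

lemma nonneg_of_posSemidef_conj_diagonal {n : Type*} [Fintype n] [DecidableEq n]
    {U : Matrix n n ℂ} (hU : Uᴴ * U = 1) {d : n → ℝ}
    (h : (U * diagonal (fun i => (d i : ℂ)) * Uᴴ).PosSemidef) (k : n) : 0 ≤ d k := by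
  have h1 := h.conjTranspose_mul_mul_same U
  rw [conjTranspose_conj_cancel hU, posSemidef_diagonal_iff] at h1
  exact_mod_cast h1 k

lemma relativeEntropy_term_nonneg {r p q : ℝ} (hr : 0 ≤ r) (hp : 0 ≤ p) (hq : 0 ≤ q)
    (hp0 : p = 0 → r = 0) (hq0 : q = 0 → r = 0) :
    0 ≤ r * Real.log r - r * (Real.log p + Real.log q) - r + p * q ∧
      (r * Real.log r - r * (Real.log p + Real.log q) - r + p * q = 0 → r = p * q) := by
  rcases hr.eq_or_lt with rfl | hr
  · exact ⟨by simp; positivity, fun h => by simp at h; simp [h]⟩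
  have hp : 0 < p := hp.lt_of_ne fun h => hr.ne' (hp0 h.symm)
  have hq : 0 < q := hq.lt_of_ne fun h => hr.ne' (hq0 h.symm)
  have hl : Real.log (p * q / r) = Real.log p + Real.log q - Real.log r := by
    rw [Real.log_div (by positivity) hr.ne', Real.log_mul hp.ne' hq.ne']
  have he : r * (p * q / r) = p * q := by field_simp
  have hx : 0 < p * q / r := by positivity
  constructor
  · have := mul_le_mul_of_nonneg_left (Real.log_le_sub_one_of_pos hx) hr.le
    rw [hl] at this
    linarith
  · intro h
    by_contra hne
    have := mul_lt_mul_of_pos_left (Real.log_lt_sub_one_of_pos hx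
      (fun h1 => hne (by rw [h1] at he; linarith))) hr
    rw [hl] at this
    linarith

/-- The equality case of classical subadditivity, for a joint distribution obtained from `r`
by a doubly stochastic `P`. -/
lemma eq_mul_of_sum_negMulLog_eq {X Y : Type*} [Fintype X] [Fintype Y]
    {P : X × Y → X × Y → ℝ} (hP : ∀ x k, 0 ≤ P x k) (hP₁ : ∀ x, ∑ k, P x k = 1)
    (hP₂ : ∀ k, ∑ x, P x k = 1) {r : X × Y → ℝ} (hr : ∀ k, 0 ≤ r k) (hr₁ : ∑ k, r k = 1)
    {p : X → ℝ} {q : Y → ℝ} (hp : ∀ i, p i = ∑ j, ∑ k, P (i, j) k * r k)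
    (hq : ∀ j, q j = ∑ i, ∑ k, P (i, j) k * r k)
    (h : ∑ i, Real.negMulLog (p i) + ∑ j, Real.negMulLog (q j) - ∑ k, Real.negMulLog (r k) = 0)
    (x k : X × Y) (hxk : P x k ≠ 0) : r k = p x.1 * q x.2 := by
  have hPr (x k) : 0 ≤ P x k * r k := mul_nonneg (hP x k) (hr k)
  have hp0 (i) : 0 ≤ p i := by
    rw [hp]; exact Finset.sum_nonneg fun _ _ => Finset.sum_nonneg fun _ _ => hPr _ _
  have hq0 (j) : 0 ≤ q j := by
    rw [hq]; exact Finset.sum_nonneg fun _ _ => Finset.sum_nonneg fun _ _ => hPr _ _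
  have hPp (x k) : P x k * r k ≤ p x.1 := by
    rw [hp]
    refine le_trans ?_ (Finset.single_le_sum (f := fun j => ∑ k, P (x.1, j) k * r k)
      (fun _ _ => Finset.sum_nonneg fun _ _ => hPr _ _) (Finset.mem_univ x.2))
    exact Finset.single_le_sum (f := fun k => P x k * r k) (fun _ _ => hPr _ _)
      (Finset.mem_univ k)
  have hPq (x k) : P x k * r k ≤ q x.2 := by
    rw [hq]
    refine le_trans ?_ (Finset.single_le_sum (f := fun i => ∑ k, P (i, x.2) k * r k)
      (fun _ _ => Finset.sum_nonneg fun _ _ => hPr _ _) (Finset.mem_univ x.1))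
    exact Finset.single_le_sum (f := fun k => P x k * r k) (fun _ _ => hPr _ _)
      (Finset.mem_univ k)
  have hterm (x k) (hxk : P x k ≠ 0) := relativeEntropy_term_nonneg (hr k) (hp0 x.1) (hq0 x.2)
    (fun h0 => by
      have := le_antisymm (h0 ▸ hPp x k) (hPr x k)
      exact (mul_eq_zero.mp this).resolve_left hxk)
    (fun h0 => by
      have := le_antisymm (h0 ▸ hPq x k) (hPr x k)
      exact (mul_eq_zero.mp this).resolve_left hxk)
  set F : X × Y → X × Y → ℝ := fun x k => P x k *
    (r k * Real.log (r k) - r k * (Real.log (p x.1) + Real.log (q x.2)) - r k + p x.1 * q x.2)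
    with hF
  have hF0 (x k) : 0 ≤ F x k := by
    by_cases hxk : P x k = 0
    · simp [hF, hxk]
    · exact mul_nonneg (hP x k) (hterm x k hxk).1
  have hsp : ∑ i, p i = 1 := by
    simp_rw [hp]
    rw [← Fintype.sum_prod_type' (f := fun i j => ∑ k, P (i, j) k * r k), Finset.sum_comm]
    simp_rw [Prod.mk.eta, ← Finset.sum_mul, hP₂, one_mul, hr₁]
  have hsq : ∑ j, q j = 1 := by
    rw [← hsp]
    simp_rw [hp, hq]
    exact Finset.sum_comm
  have hsum : ∑ x, ∑ k, F x k = 0 := by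
    have e1 : ∑ x, ∑ k, P x k * (r k * Real.log (r k)) = ∑ k, r k * Real.log (r k) := by
      rw [Finset.sum_comm]
      simp_rw [← Finset.sum_mul, hP₂, one_mul]
    have e2 : ∑ x : X × Y, ∑ k, P x k * r k * Real.log (p x.1) = ∑ i, p i * Real.log (p i) := by
      rw [Fintype.sum_prod_type]
      simp_rw [← Finset.sum_mul, ← hp]
    have e3 : ∑ x : X × Y, ∑ k, P x k * r k * Real.log (q x.2) = ∑ j, q j * Real.log (q j) := by
      rw [Fintype.sum_prod_type_right]
      simp_rw [← Finset.sum_mul, ← hq]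
    have e4 : ∑ x, ∑ k, P x k * r k = 1 := by
      rw [Finset.sum_comm]
      simp_rw [← Finset.sum_mul, hP₂, one_mul, hr₁]
    have e5 : ∑ x : X × Y, ∑ k, P x k * (p x.1 * q x.2) = 1 := by
      simp_rw [← Finset.sum_mul, hP₁, one_mul]
      rw [Fintype.sum_prod_type]
      simp_rw [← Finset.mul_sum, hsq, mul_one, hsp]
    have e : ∀ x k, F x k = P x k * (r k * Real.log (r k)) - P x k * r k * Real.log (p x.1)
        - P x k * r k * Real.log (q x.2) - P x k * r k + P x k * (p x.1 * q x.2) := by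
      intro x k; simp only [hF]; ring
    simp_rw [e, Finset.sum_add_distrib, Finset.sum_sub_distrib]
    rw [e1, e2, e3, e4, e5]
    simp only [Real.negMulLog, neg_mul, Finset.sum_neg_distrib] at h
    linarith
  have h1 := (Finset.sum_eq_zero_iff_of_nonneg fun x _ =>
    Finset.sum_nonneg fun k _ => hF0 x k).mp hsum x (Finset.mem_univ _)
  have h2 := (Finset.sum_eq_zero_iff_of_nonneg fun k _ => hF0 x k).mp h1 k (Finset.mem_univ _)
  exact (hterm x k hxk).2 ((mul_eq_zero.mp h2).resolve_left hxk)

lemma trace_mul_kronecker_one {X Y : Type*} [Fintype X] [DecidableEq X] [Fintype Y]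
    [DecidableEq Y] (τ : Matrix (X × Y) (X × Y) ℂ) (A : Matrix X X ℂ) :
    (τ * (A ⊗ₖ (1 : Matrix Y Y ℂ))).trace =
      ((Matrix.of fun x x' => ∑ y, τ (x, y) (x', y)) * A).trace := by
  simp only [trace, diag_apply, mul_apply, Fintype.sum_prod_type, kroneckerMap_apply, one_apply,
    mul_ite, mul_one, mul_zero, Finset.sum_ite_eq', Finset.mem_univ, if_true, of_apply,
    Finset.sum_mul]
  exact Finset.sum_congr rfl fun _ _ => Finset.sum_comm

lemma trace_mul_one_kronecker {X Y : Type*} [Fintype X] [DecidableEq X] [Fintype Y]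
    [DecidableEq Y] (τ : Matrix (X × Y) (X × Y) ℂ) (A : Matrix Y Y ℂ) :
    (τ * ((1 : Matrix X X ℂ) ⊗ₖ A)).trace =
      ((Matrix.of fun y y' => ∑ x, τ (x, y) (x, y')) * A).trace := by
  simp only [trace, diag_apply, mul_apply, Fintype.sum_prod_type_right, kroneckerMap_apply,
    one_apply, ite_mul, mul_ite, one_mul, zero_mul, mul_zero, Finset.sum_ite_eq',
    Finset.mem_univ, if_true, of_apply, Finset.sum_mul]
  exact Finset.sum_congr rfl fun _ _ => Finset.sum_comm

lemma conjTranspose_kronecker_mul_self {X Y : Type*} [Fintype X] [DecidableEq X] [Fintype Y]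
    [DecidableEq Y] {U : Matrix X X ℂ} {V : Matrix Y Y ℂ} (hU : Uᴴ * U = 1) (hV : Vᴴ * V = 1) :
    (U ⊗ₖ V)ᴴ * (U ⊗ₖ V) = 1 := by
  rw [conjTranspose_kronecker, ← mul_kronecker_mul, hU, hV, one_kronecker_one]

lemma reduced_left_conj_kronecker {X Y : Type*} [Fintype X] [DecidableEq X] [Fintype Y]
    [DecidableEq Y] (τ : Matrix (X × Y) (X × Y) ℂ) (U : Matrix X X ℂ) {V : Matrix Y Y ℂ}
    (hV : V * Vᴴ = 1) :
    (Matrix.of fun x x' => ∑ y, ((U ⊗ₖ V)ᴴ * τ * (U ⊗ₖ V)) (x, y) (x', y)) =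
      Uᴴ * (Matrix.of fun x x' => ∑ y, τ (x, y) (x', y)) * U := by
  refine ext_iff_trace_mul_right.mpr fun A => ?_
  rw [← trace_mul_kronecker_one, mul_assoc, mul_assoc, trace_mul_comm, mul_assoc, mul_assoc,
    conjTranspose_kronecker, ← mul_kronecker_mul, ← mul_kronecker_mul, one_mul, hV,
    trace_mul_kronecker_one, mul_assoc Uᴴ, mul_assoc Uᴴ, trace_mul_comm Uᴴ]
  simp only [mul_assoc]

lemma reduced_right_conj_kronecker {X Y : Type*} [Fintype X] [DecidableEq X] [Fintype Y]
    [DecidableEq Y] (τ : Matrix (X × Y) (X × Y) ℂ) {U : Matrix X X ℂ} (V : Matrix Y Y ℂ)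
    (hU : U * Uᴴ = 1) :
    (Matrix.of fun y y' => ∑ x, ((U ⊗ₖ V)ᴴ * τ * (U ⊗ₖ V)) (x, y) (x, y')) =
      Vᴴ * (Matrix.of fun y y' => ∑ x, τ (x, y) (x, y')) * V := by
  refine ext_iff_trace_mul_right.mpr fun A => ?_
  rw [← trace_mul_one_kronecker, mul_assoc, mul_assoc, trace_mul_comm, mul_assoc, mul_assoc,
    conjTranspose_kronecker, ← mul_kronecker_mul, ← mul_kronecker_mul, one_mul, hU,
    trace_mul_one_kronecker, mul_assoc Vᴴ, mul_assoc Vᴴ, trace_mul_comm Vᴴ]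
  simp only [mul_assoc]

lemma conj_diagonal_apply_self {n : Type*} [Fintype n] [DecidableEq n] (Q : Matrix n n ℂ)
    (r : n → ℝ) (x : n) :
    (Q * diagonal (fun k => (r k : ℂ)) * Qᴴ) x x =
      ((∑ k, Complex.normSq (Q x k) * r k : ℝ) : ℂ) := by
  rw [mul_apply]
  simp only [mul_diagonal, conjTranspose_apply]
  push_cast
  refine Finset.sum_congr rfl fun k _ => ?_
  rw [← Complex.mul_conj]
  simp only [RCLike.star_def]
  ring

lemma sum_normSq_row {n : Type*} [Fintype n] [DecidableEq n] {Q : Matrix n n ℂ}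
    (hQ : Q * Qᴴ = 1) (x : n) : ∑ k, Complex.normSq (Q x k) = 1 := by
  have h := conj_diagonal_apply_self Q (fun _ => 1) x
  simp only [Complex.ofReal_one, diagonal_one, mul_one, hQ, one_apply_eq] at h
  exact_mod_cast h.symm

/-- The equality case of subadditivity of the von Neumann entropy. -/
lemma eq_kronecker_of_vNEntropy_eq {X Y : Type*} [Fintype X] [DecidableEq X] [Fintype Y]
    [DecidableEq Y] {τ : Matrix (X × Y) (X × Y) ℂ} (hτ : IsDensityMatrix τ)
    {a : Matrix X X ℂ} (ha : a = Matrix.of fun x x' => ∑ y, τ (x, y) (x', y))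
    {b : Matrix Y Y ℂ} (hb : b = Matrix.of fun y y' => ∑ x, τ (x, y) (x, y'))
    (h : vNEntropy a + vNEntropy b - vNEntropy τ = 0) : τ = a ⊗ₖ b := by
  have haH : a.IsHermitian := by
    subst ha
    ext x x'
    simp [fun y => hτ.1.isHermitian.apply (x, y) (x', y)]
  have hbH : b.IsHermitian := by
    subst hb
    ext y y'
    simp [fun x => hτ.1.isHermitian.apply (x, y) (x, y')]
  obtain ⟨U, p, hU, hU', hap⟩ := exists_unitary_diagonalization haH
  obtain ⟨V, q, hV, hV', hbq⟩ := exists_unitary_diagonalization hbH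
  obtain ⟨W, r, hW, hW', hτr⟩ := exists_unitary_diagonalization hτ.1.isHermitian
  have hN := conjTranspose_kronecker_mul_self hU hV
  set N := U ⊗ₖ V with hNdef
  have hN' : N * Nᴴ = 1 := mul_eq_one_comm.mp hN
  set Q := Nᴴ * W with hQdef
  have hQ : Qᴴ * Q = 1 := by
    rw [hQdef, conjTranspose_mul, conjTranspose_conjTranspose, mul_assoc, ← mul_assoc N, hN',
      one_mul, hW]
  have hQ' : Q * Qᴴ = 1 := mul_eq_one_comm.mp hQ
  have hT : Nᴴ * τ * N = Q * diagonal (fun k => (r k : ℂ)) * Qᴴ := by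
    rw [hτr, hQdef, conjTranspose_mul, conjTranspose_conjTranspose]
    simp only [mul_assoc]
  have hr : ∀ k, 0 ≤ r k := nonneg_of_posSemidef_conj_diagonal hW (hτr ▸ hτ.1)
  have hr₁ : ∑ k, r k = 1 := by
    have h1 := hτ.2
    rw [hτr, trace_mul_comm, ← mul_assoc, hW, one_mul, trace_diagonal] at h1
    exact_mod_cast h1
  have hp : ∀ i, p i = ∑ j, ∑ k, Complex.normSq (Q (i, j) k) * r k := by
    intro i
    have h1 := congrFun (congrFun (reduced_left_conj_kronecker τ U hV') i) i
    rw [← ha, hap, ← hNdef, hT, conjTranspose_conj_cancel hU, diagonal_apply_eq, of_apply] at h1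
    simp only [conj_diagonal_apply_self] at h1
    exact_mod_cast h1.symm
  have hq : ∀ j, q j = ∑ i, ∑ k, Complex.normSq (Q (i, j) k) * r k := by
    intro j
    have h1 := congrFun (congrFun (reduced_right_conj_kronecker τ V hU') j) j
    rw [← hb, hbq, ← hNdef, hT, conjTranspose_conj_cancel hV, diagonal_apply_eq, of_apply] at h1
    simp only [conj_diagonal_apply_self] at h1
    exact_mod_cast h1.symm
  rw [hap, hbq, hτr, vNEntropy_unitary_conj_diagonal hU, vNEntropy_unitary_conj_diagonal hV,
    vNEntropy_unitary_conj_diagonal hW] at h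
  have key := eq_mul_of_sum_negMulLog_eq (P := fun x k => Complex.normSq (Q x k))
    (fun _ _ => Complex.normSq_nonneg _) (sum_normSq_row hQ')
    (fun k => by
      simpa using sum_normSq_row (Q := Qᴴ) (by rwa [conjTranspose_conjTranspose]) k)
    hr hr₁ hp hq h
  have hcomm : Q * diagonal (fun k => (r k : ℂ)) =
      diagonal (fun x : X × Y => ((p x.1 : ℂ) * (q x.2 : ℂ))) * Q := by
    ext x k
    rw [mul_diagonal, diagonal_mul, mul_comm]
    by_cases hx : Q x k = 0
    · simp [hx]
    · rw [key x k (by simpa using hx)]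
      push_cast
      rfl
  rw [hcomm, mul_assoc _ Q, hQ', mul_one] at hT
  calc τ = N * (Nᴴ * τ * N) * Nᴴ := by
        rw [← mul_assoc, ← mul_assoc, hN', one_mul, mul_assoc, hN', mul_one]
    _ = a ⊗ₖ b := by
        rw [hT, hap, hbq, mul_kronecker_mul, mul_kronecker_mul, diagonal_kronecker_diagonal,
          ← conjTranspose_kronecker]

lemma vNEntropy_kronecker {X Y : Type*} [Fintype X] [DecidableEq X] [Fintype Y]
    [DecidableEq Y] {a : Matrix X X ℂ} {b : Matrix Y Y ℂ} (ha : a.IsHermitian)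
    (hb : b.IsHermitian) (ha₁ : a.trace = 1) (hb₁ : b.trace = 1) :
    vNEntropy (a ⊗ₖ b) = vNEntropy a + vNEntropy b := by
  obtain ⟨U, p, hU, -, rfl⟩ := exists_unitary_diagonalization ha
  obtain ⟨V, q, hV, -, rfl⟩ := exists_unitary_diagonalization hb
  rw [trace_mul_comm, ← mul_assoc, hU, one_mul, trace_diagonal] at ha₁
  rw [trace_mul_comm, ← mul_assoc, hV, one_mul, trace_diagonal] at hb₁
  have hp : ∑ i, p i = 1 := by exact_mod_cast ha₁
  have hq : ∑ j, q j = 1 := by exact_mod_cast hb₁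
  have hd := vNEntropy_unitary_conj_diagonal (conjTranspose_kronecker_mul_self hU hV)
    (fun x : X × Y => p x.1 * q x.2)
  simp only [Complex.ofReal_mul] at hd
  rw [mul_kronecker_mul, mul_kronecker_mul, diagonal_kronecker_diagonal,
    ← conjTranspose_kronecker, hd, vNEntropy_unitary_conj_diagonal hU,
    vNEntropy_unitary_conj_diagonal hV, Fintype.sum_prod_type]
  simp_rw [Real.negMulLog_mul, Finset.sum_add_distrib, ← Finset.sum_mul, ← Finset.mul_sum]
  rw [← Finset.sum_mul, hp, hq, one_mul, one_mul]

lemma exists_eq_mul_conjTranspose {n : Type*} [Fintype n] [DecidableEq n]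
    {A : Matrix n n ℂ} (hA : A.PosSemidef) : ∃ M : Matrix n n ℂ, A = M * Mᴴ := by
  obtain ⟨U, d, hU, -, rfl⟩ := exists_unitary_diagonalization hA.isHermitian
  have hd := nonneg_of_posSemidef_conj_diagonal hU hA
  refine ⟨U * diagonal fun i => ((Real.sqrt (d i) : ℝ) : ℂ), ?_⟩
  have hs : (fun i => (d i : ℂ)) =
      fun i => ((Real.sqrt (d i) : ℝ) : ℂ) * ((Real.sqrt (d i) : ℝ) : ℂ) := by
    ext i
    rw [← Complex.ofReal_mul, Real.mul_self_sqrt (hd i)]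
  rw [conjTranspose_mul, diagonal_conjTranspose, hs, ← diagonal_mul_diagonal]
  simp only [mul_assoc]
  congr 4
  ext i
  simp

/-- For a density matrix `ρ` on `H_C ⊗ H_B ⊗ H_B'`:
if `S(C) + S(CB) - S(B) = 0` then `S(C) + S(CBB') - S(BB') = 0`
(extension of axiom A0: `S(C) + S(C|B)` is nonnegative and non-increasing in `B`). -/
theorem A0_extends_to_larger_region
    {C B B' : Type*} [Fintype C] [DecidableEq C] [Fintype B] [DecidableEq B]
    [Fintype B'] [DecidableEq B']
    (ρ : Matrix (C × B × B') (C × B × B') ℂ) (hρ : IsDensityMatrix ρ)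
    (ρC : Matrix C C ℂ)
    (hρC : ρC = Matrix.of fun c c' => ∑ b : B, ∑ b' : B', ρ (c, b, b') (c', b, b'))
    (ρCB : Matrix (C × B) (C × B) ℂ)
    (hρCB : ρCB = Matrix.of fun p q => ∑ b' : B', ρ (p.1, p.2, b') (q.1, q.2, b'))
    (ρB : Matrix B B ℂ)
    (hρB : ρB = Matrix.of fun b b'' => ∑ c : C, ∑ b' : B', ρ (c, b, b') (c, b'', b'))
    (ρBB' : Matrix (B × B') (B × B') ℂ)
    (hρBB' : ρBB' = Matrix.of fun p q => ∑ c : C, ρ (c, p) (c, q))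
    (hA0 : vNEntropy ρC + vNEntropy ρCB - vNEntropy ρB = 0) :
    vNEntropy ρC + vNEntropy ρ - vNEntropy ρBB' = 0 := by
  obtain ⟨M, hM⟩ := exists_eq_mul_conjTranspose hρ.1
  have hM' : ∀ x y, ρ x y = ∑ e, M x e * star (M y e) := fun x y => by
    rw [hM, mul_apply]; rfl
  have htr : ∑ c, ∑ b, ∑ b', ρ (c, b, b') (c, b, b') = 1 := by
    simpa only [trace, diag_apply, Fintype.sum_prod_type] using hρ.2
  -- `M` purifies `ρ` with an ancilla `E`; `τ`, `σ`, `κ`, `ω` are the reduced states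
  -- on `CB'E`, `B'E`, `CE` and `E`.
  let τ : Matrix (C × B' × C × B × B') (C × B' × C × B × B') ℂ :=
    Matrix.of fun f f' => ∑ b, M (f.1, b, f.2.1) f.2.2 * star (M (f'.1, b, f'.2.1) f'.2.2)
  let σ : Matrix (B' × C × B × B') (B' × C × B × B') ℂ :=
    Matrix.of fun f f' => ∑ p : C × B, M (p.1, p.2, f.1) f.2 * star (M (p.1, p.2, f'.1) f'.2)
  let κ : Matrix (C × C × B × B') (C × C × B × B') ℂ :=
    Matrix.of fun f f' => ∑ p : B × B', M (f.1, p) f.2 * star (M (f'.1, p) f'.2)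
  let ω : Matrix (C × B × B') (C × B × B') ℂ :=
    Matrix.of fun e e' => ∑ x, M x e * star (M x e')
  have hSρ : vNEntropy ρ = vNEntropy ω := by
    rw [show ρ = Matrix.of fun x y => ∑ e, M x e * star (M y e) from Matrix.ext hM']
    exact vNEntropy_reduced_eq M
  have hSCB : vNEntropy ρCB = vNEntropy σ := by
    convert vNEntropy_reduced_eq (m := C × B) (n := B' × C × B × B')
      (fun p f => M (p.1, p.2, f.1) f.2) using 2
    rw [hρCB]
    ext p q
    simp only [of_apply, hM', Fintype.sum_prod_type (α₁ := B')]
  have hSB : vNEntropy ρB = vNEntropy τ := by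
    convert vNEntropy_reduced_eq (m := B) (n := C × B' × C × B × B')
      (fun b f => M (f.1, b, f.2.1) f.2.2) using 2
    rw [hρB]
    ext b b''
    simp only [of_apply, hM', Fintype.sum_prod_type (α₂ := B' × C × B × B'),
      Fintype.sum_prod_type (α₂ := C × B × B')]
  have hSBB' : vNEntropy ρBB' = vNEntropy κ := by
    convert vNEntropy_reduced_eq (m := B × B') (n := C × C × B × B')
      (fun p f => M (f.1, p) f.2) using 2
    rw [hρBB']
    ext p q
    simp only [of_apply, hM', Fintype.sum_prod_type (α₂ := C × B × B')]
  have hτC : ρC = Matrix.of fun c c' => ∑ f, τ (c, f) (c', f) := by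
    rw [hρC]
    ext c c'
    simp only [of_apply, τ, hM']
    rw [Finset.sum_comm (s := (Finset.univ : Finset (B' × C × B × B')))]
    simp only [Fintype.sum_prod_type (α₂ := C × B × B')]
  have hτσ : σ = Matrix.of fun f f' => ∑ c, τ (c, f) (c, f') := by
    ext f f'
    simp only [of_apply, τ, σ, Fintype.sum_prod_type]
  have hτ : IsDensityMatrix τ := by
    constructor
    · have : τ = (Matrix.of fun (f : C × B' × C × B × B') b => M (f.1, b, f.2.1) f.2.2) *
          (Matrix.of fun (f : C × B' × C × B × B') b => M (f.1, b, f.2.1) f.2.2)ᴴ := by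
        ext f f'
        simp [τ, mul_apply]
      rw [this]
      exact posSemidef_self_mul_conjTranspose _
    · rw [← htr]
      have h1 (c : C) : ∑ f, τ (c, f) (c, f) = ρC c c := by rw [hτC]; rfl
      simp only [trace, diag_apply, Fintype.sum_prod_type (α₂ := B' × C × B × B'), h1, hρC,
        of_apply]
  rw [hSCB, hSB] at hA0
  have hprod := eq_kronecker_of_vNEntropy_eq hτ hτC hτσ hA0
  have hκ : κ = ρC ⊗ₖ ω := by
    ext ⟨c, e⟩ ⟨c', e'⟩
    have h1 : κ (c, e) (c', e') = ∑ b', τ (c, b', e) (c', b', e') := by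
      simp only [κ, τ, of_apply, Fintype.sum_prod_type_right]
    have h2 : ω e e' = ∑ b', σ (b', e) (b', e') := by
      simp only [ω, σ, of_apply]
      rw [Finset.sum_comm]
      simp only [Fintype.sum_prod_type]
    rw [h1, hprod, kroneckerMap_apply, h2, Finset.mul_sum]
    rfl
  have hCH : ρC.IsHermitian := by
    rw [hρC]
    ext c c'
    simp [fun b b' => hρ.1.isHermitian.apply (c, b, b') (c', b, b')]
  have hωH : ω.IsHermitian := by
    ext e e'
    simp [ω, mul_comm]
  have hC₁ : ρC.trace = 1 := by rw [← htr, hρC]; rfl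
  have hω₁ : ω.trace = 1 := by
    rw [← hρ.2]
    simp only [trace, diag_apply, ω, of_apply, hM']
    exact Finset.sum_comm
  rw [hSρ, hSBB', hκ, vNEntropy_kronecker hCH hωH hC₁ hω₁, sub_self]
end
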